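/- Let n ≥ 3, let α be a constant, and let λ = (λ_1,…,λ_n) ∈ ℝ^n. Then for all distinct indices p, q with p ≠ 1 and q ≠ 1, the following algebraic identity holds: −λ_1²·S_n^{11,pp}(λ)·S_n^{11,qq}(λ) + λ_1·S_n^{11}(λ)·S_n^{pp,qq}(λ) = −λ_1²·σ_{n−3}(λ|1pq)² + λ_1·S_{n−1}(λ|1)·σ_{n−3}(λ|1pq), where S_n^{11}(λ) = S_{n−1}(λ|1), S_n^{11,ii}(λ) = S_{n−2}(λ|1i), S_n^{pp,qq}(λ) = S_{n−2}(λ|pq), and (λ|1pq) is λ with the entries indexed 1, p, q deleted. -/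

import Mathlib

open Finset

/-- The `j`-th elementary symmetric polynomial of `lam` restricted to the index set `A`,
with `σ_0 = 1` and `σ_j = 0` for `j < 0` or `j > |A|`. -/
noncomputable def esigma {n : ℕ} (A : Finset (Fin n)) (j : ℤ) (lam : Fin n → ℝ) : ℝ :=
  if 0 ≤ j then ∑ s ∈ A.powersetCard j.toNat, ∏ i ∈ s, lam i else 0

/-- The sum Hessian operator `S_j(λ) = σ_{j-1}(λ) + α σ_j(λ)` on the index set `A`. -/
noncomputable def Ssum {n : ℕ} (α : ℝ) (A : Finset (Fin n)) (j : ℤ) (lam : Fin n → ℝ) : ℝ :=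
  esigma A (j - 1) lam + α * esigma A j lam

/-- The Gårding cone `Γ_k`. -/
def Gamma (n k : ℕ) : Set (Fin n → ℝ) :=
  {lam | ∀ j : ℕ, 1 ≤ j → j ≤ k → 0 < esigma Finset.univ (j : ℤ) lam}

/-- The admissible cone `Γ̃_k = Γ_{k-1} ∩ {S_k > 0}`. -/
def GammaTilde (n k : ℕ) (α : ℝ) : Set (Fin n → ℝ) :=
  Gamma n (k - 1) ∩ {lam | 0 < Ssum α Finset.univ (k : ℤ) lam}

/-- Pascal-type recursion for elementary symmetric polynomials, valid for every integer degree. -/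
theorem esigma_insert {n : ℕ} {A : Finset (Fin n)} {a : Fin n} (ha : a ∉ A) (j : ℤ)
    (lam : Fin n → ℝ) :
    esigma (insert a A) j lam = esigma A j lam + lam a * esigma A (j - 1) lam := by
  unfold esigma
  rcases lt_or_ge j 0 with hj | hj
  · rw [if_neg (by omega), if_neg (by omega), if_neg (by omega)]
    simp
  · lift j to ℕ using hj
    cases j with
    | zero => simp
    | succ k =>
      have hk : ((k + 1 : ℕ) : ℤ) - 1 = (k : ℤ) := by push_cast; ring
      rw [hk, if_pos (by omega), if_pos (by omega), if_pos (by omega), Int.toNat_natCast,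
        Int.toNat_natCast, powersetCard_succ_insert ha, sum_union, sum_image, mul_sum]
      · congr 1
        refine sum_congr rfl fun s hs => prod_insert fun h => ha ?_
        exact (mem_powersetCard.1 hs).1 h
      · intro s hs t ht hst
        have hs' : a ∉ s := fun h => ha ((mem_powersetCard.1 hs).1 h)
        have ht' : a ∉ t := fun h => ha ((mem_powersetCard.1 ht).1 h)
        rw [← erase_insert hs', ← erase_insert ht', hst]
      · rw [disjoint_left]
        intro s hs hs'
        obtain ⟨t, -, rfl⟩ := mem_image.1 hs'
        exact ha ((mem_powersetCard.1 hs).1 (mem_insert_self a t))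

theorem esigma_eq_zero_of_card_lt {n : ℕ} {A : Finset (Fin n)} {j : ℤ} (hj : (#A : ℤ) < j)
    (lam : Fin n → ℝ) : esigma A j lam = 0 := by
  unfold esigma
  rw [if_pos (by omega), powersetCard_eq_empty.2 (by omega), sum_empty]

theorem Ssum_insert {n : ℕ} (α : ℝ) {A : Finset (Fin n)} {a : Fin n} (ha : a ∉ A) (j : ℤ)
    (lam : Fin n → ℝ) :
    Ssum α (insert a A) j lam = Ssum α A j lam + lam a * Ssum α A (j - 1) lam := by
  unfold Ssum
  rw [esigma_insert ha, esigma_insert ha]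
  ring

/-- Lemma 3.1 (iii): the algebraic identity
`-λ_1² S_n^{11,pp} S_n^{11,qq} + λ_1 S_n^{11} S_n^{pp,qq}
  = -λ_1² σ_{n-3}(λ|1pq)² + λ_1 S_{n-1}(λ|1) σ_{n-3}(λ|1pq)`. -/
theorem Sn_identity_iii {n : ℕ} (hn : 3 ≤ n) (α : ℝ) (lam : Fin n → ℝ)
    (p q : Fin n) (hpq : p ≠ q) (hp : p ≠ ⟨0, by omega⟩) (hq : q ≠ ⟨0, by omega⟩) :
    -((lam ⟨0, by omega⟩) ^ 2)
        * Ssum α (Finset.univ \ {(⟨0, by omega⟩ : Fin n), p}) ((n : ℤ) - 2) lam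
        * Ssum α (Finset.univ \ {(⟨0, by omega⟩ : Fin n), q}) ((n : ℤ) - 2) lam
      + lam ⟨0, by omega⟩
        * Ssum α (Finset.univ \ {(⟨0, by omega⟩ : Fin n)}) ((n : ℤ) - 1) lam
        * Ssum α (Finset.univ \ {p, q}) ((n : ℤ) - 2) lam
    = -((lam ⟨0, by omega⟩) ^ 2)
          * (esigma (Finset.univ \ {(⟨0, by omega⟩ : Fin n), p, q}) ((n : ℤ) - 3) lam) ^ 2
      + lam ⟨0, by omega⟩
          * Ssum α (Finset.univ \ {(⟨0, by omega⟩ : Fin n)}) ((n : ℤ) - 1) lam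
          * esigma (Finset.univ \ {(⟨0, by omega⟩ : Fin n), p, q}) ((n : ℤ) - 3) lam := by
  generalize_proofs h₀ at *
  set o : Fin n := ⟨0, h₀⟩
  set B : Finset (Fin n) := univ \ {o, p, q} with hB
  have hoB : o ∉ B := by simp [hB]
  have hpB : p ∉ B := by simp [hB]
  have hqB : q ∉ B := by simp [hB]
  have hcard : (#B : ℤ) = n - 3 := by
    have h3 : #({o, p, q} : Finset (Fin n)) = 3 :=
      card_eq_three.2 ⟨o, p, q, hp.symm, hq.symm, hpq, rfl⟩
    rw [hB, card_sdiff_of_subset (subset_univ _), h3, card_univ, Fintype.card_fin]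
    omega
  have hop : univ \ {o, p} = insert q B := by ext i; simp [hB]; grind
  have hoq : univ \ {o, q} = insert p B := by ext i; simp [hB]; grind
  have hpq' : univ \ {p, q} = insert o B := by ext i; simp [hB]; grind
  have ho : univ \ {o} = insert p (insert q B) := by ext i; simp [hB]; grind
  have hp' : p ∉ insert q B := by simp [hpq, hpB]
  have htop : Ssum α B ((n : ℤ) - 2) lam = esigma B ((n : ℤ) - 3) lam := by
    rw [Ssum, esigma_eq_zero_of_card_lt (j := (n : ℤ) - 2) (by omega),
      show (n : ℤ) - 2 - 1 = n - 3 by ring]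
    ring
  have hvanish : Ssum α B ((n : ℤ) - 1) lam = 0 := by
    rw [Ssum, esigma_eq_zero_of_card_lt (by omega), esigma_eq_zero_of_card_lt (by omega)]
    ring
  rw [hop, hoq, hpq', ho, Ssum_insert α hp', Ssum_insert α hqB, Ssum_insert α hqB,
    Ssum_insert α hpB, Ssum_insert α hoB, show (n : ℤ) - 1 - 1 = n - 2 by ring,
    Ssum_insert α hqB, htop, hvanish]
  ring
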